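/- Let p, q be non-crossing partitions of Fin n. The following are equivalent: (1) p ⪯ q in NC(n); (2) there exists r ∈ NC(n) with s_q = s_p · s_r and ℓ_T(s_p) + ℓ_T(s_r) = ℓ_T(s_q) (left divisibility); (3) there exists r ∈ NC(n) with s_q = s_r · s_p and ℓ_T(s_r) + ℓ_T(s_p) = ℓ_T(s_q) (right divisibility); (4) s_p ≤_T s_q in the absolute order on Sₙ. -/

import Mathlib

open Finset

/-- A partition of `Fin n` is *non-crossing* if there are no indices `a < b < c < d`
such that `a` and `c` lie in one block while `b` and `d` lie in a different block. -/
def IsNoncrossing {n : ℕ} {s : Finset (Fin n)} (P : Finpartition s) : Prop :=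
  ¬ ∃ a b c d : Fin n, a < b ∧ b < c ∧ c < d ∧
    ∃ B ∈ P.parts, ∃ B' ∈ P.parts, B ≠ B' ∧ a ∈ B ∧ c ∈ B ∧ b ∈ B' ∧ d ∈ B'

/-- The poset of non-crossing partitions of `Fin n`, ordered by refinement. -/
abbrev NC (n : ℕ) := {P : Finpartition (univ : Finset (Fin n)) // IsNoncrossing P}

/-- `σ` is the permutation associated to the partition `P`: the product over the blocks
`B = {a₁ < a₂ < ⋯ < a_k}` of `P` of the cycles `a₁ ↦ a₂ ↦ ⋯ ↦ a_k ↦ a₁`.  Pointwise,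
`σ` sends each `x` to the least element of its block that is greater than `x`, if one
exists, and to the least element of its block otherwise. -/
def IsBlockRotation {n : ℕ} (P : Finpartition (univ : Finset (Fin n)))
    (σ : Equiv.Perm (Fin n)) : Prop :=
  ∀ x : Fin n,
    σ x = if h : ((P.part x).filter (x < ·)).Nonempty
      then ((P.part x).filter (x < ·)).min' h
      else (P.part x).min' ⟨x, P.mem_part (Finset.mem_univ x)⟩

/-- The reflection length of a permutation `σ` with respect to the set `T` of
transpositions: the least `k` such that `σ` is a product of `k` transpositions. -/
noncomputable def reflectionLength {n : ℕ} (σ : Equiv.Perm (Fin n)) : ℕ :=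
  sInf {k | ∃ l : List (Equiv.Perm (Fin n)),
    l.length = k ∧ (∀ t ∈ l, t.IsSwap) ∧ l.prod = σ}

/-- The absolute order on the symmetric group: `σ ≤_T τ` iff
`ℓ_T(σ) + ℓ_T(σ⁻¹ τ) = ℓ_T(τ)`. -/
noncomputable def absoluteLe {n : ℕ} (σ τ : Equiv.Perm (Fin n)) : Prop :=
  reflectionLength σ + reflectionLength (σ⁻¹ * τ) = reflectionLength τ

/-- The functions `Fin n → ℚ` that are invariant under `σ`. -/
def invariantFunctions {n : ℕ} (σ : Equiv.Perm (Fin n)) : Submodule ℚ (Fin n → ℚ) where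
  carrier := {f | ∀ x, f (σ x) = f x}
  add_mem' hf hg x := by simp [hf x, hg x]
  zero_mem' _ := rfl
  smul_mem' c f hf x := by simp [hf x]

section InvariantFunctions

variable {n : ℕ} {σ τ a b : Equiv.Perm (Fin n)}

lemma mem_invariantFunctions {f : Fin n → ℚ} :
    f ∈ invariantFunctions σ ↔ ∀ x, f (σ x) = f x := Iff.rfl

lemma indicator_mem_invariantFunctions {S : Set (Fin n)} (h : ∀ x, σ x ∈ S ↔ x ∈ S) :
    S.indicator 1 ∈ invariantFunctions σ := by
  classical
  intro x
  simp [Set.indicator_apply, h]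

lemma inf_le_invariantFunctions_mul :
    invariantFunctions a ⊓ invariantFunctions b ≤ invariantFunctions (a * b) :=
  fun _ hf x => (hf.1 (b x)).trans (hf.2 x)

lemma eq_of_sameCycle {f : Fin n → ℚ} (hf : f ∈ invariantFunctions σ) {x y : Fin n}
    (h : σ.SameCycle x y) : f x = f y := by
  obtain ⟨k, -, -, rfl⟩ := h.exists_pow_eq'
  induction k with
  | zero => rfl
  | succ k ih => rw [pow_succ', Equiv.Perm.mul_apply, hf]; exact ih ⟨k, rfl⟩

lemma sameCycle_of_le (h : invariantFunctions τ ≤ invariantFunctions σ) (x : Fin n) :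
    τ.SameCycle x (σ x) := by
  classical
  have h1 := h (indicator_mem_invariantFunctions (S := {y | τ.SameCycle x y})
    (fun y => Equiv.Perm.sameCycle_apply_right)) x
  by_contra hc
  simp [hc, Equiv.Perm.SameCycle.refl τ x] at h1

lemma mem_invariantFunctions_swap {u v : Fin n} {f : Fin n → ℚ} :
    f ∈ invariantFunctions (Equiv.swap u v) ↔ f u = f v := by
  constructor
  · intro h
    simpa using (h v)
  · intro h x
    rcases eq_or_ne x u with rfl | hu
    · simp [h]
    rcases eq_or_ne x v with rfl | hv
    · simp [h]
    rw [Equiv.swap_apply_of_ne_of_ne hu hv]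

lemma finrank_invariantFunctions_le :
    Module.finrank ℚ (invariantFunctions σ) ≤ n := by
  simpa using (invariantFunctions σ).finrank_le

lemma finrank_add_le_inf :
    Module.finrank ℚ (invariantFunctions a) + Module.finrank ℚ (invariantFunctions b) ≤
      n + Module.finrank ℚ ↥(invariantFunctions a ⊓ invariantFunctions b) := by
  have hsum := Submodule.finrank_sup_add_finrank_inf_eq (invariantFunctions a)
    (invariantFunctions b)
  have hle := (invariantFunctions a ⊔ invariantFunctions b).finrank_le
  simp only [Module.finrank_fintype_fun_eq_card, Fintype.card_fin] at hle
  omega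

lemma finrank_add_le_mul :
    Module.finrank ℚ (invariantFunctions a) + Module.finrank ℚ (invariantFunctions b) ≤
      n + Module.finrank ℚ (invariantFunctions (a * b)) :=
  finrank_add_le_inf.trans
    (Nat.add_le_add_left (Submodule.finrank_mono inf_le_invariantFunctions_mul) n)

lemma le_finrank_swap (u v : Fin n) :
    n ≤ 1 + Module.finrank ℚ (invariantFunctions (Equiv.swap u v)) := by
  let φ : (Fin n → ℚ) →ₗ[ℚ] ℚ :=
    LinearMap.proj (R := ℚ) (φ := fun _ => ℚ) u - LinearMap.proj (R := ℚ) (φ := fun _ => ℚ) v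
  have h : invariantFunctions (Equiv.swap u v) = LinearMap.ker φ := by
    ext f
    rw [mem_invariantFunctions_swap]
    simp [φ, sub_eq_zero]
  have h1 := φ.finrank_range_add_finrank_ker
  have h2 := (LinearMap.range φ).finrank_le
  simp only [Module.finrank_fintype_fun_eq_card, Fintype.card_fin, Module.finrank_self] at h1 h2
  rw [h]
  omega

lemma le_invariantFunctions_mul_swap {u v : Fin n} (h : τ.SameCycle u v) :
    invariantFunctions τ ≤ invariantFunctions (τ * Equiv.swap u v) := fun _ hf =>
  inf_le_invariantFunctions_mul ⟨hf, mem_invariantFunctions_swap.2 (eq_of_sameCycle hf h)⟩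

/-- Multiplying by the transposition that makes `x` a fixed point enlarges the space of
invariant functions. -/
lemma invariantFunctions_lt_mul_swap {x : Fin n} (hx : σ x ≠ x) :
    invariantFunctions σ < invariantFunctions (σ * Equiv.swap x (σ.symm x)) := by
  classical
  refine lt_of_le_of_ne (le_invariantFunctions_mul_swap
    (Equiv.Perm.sameCycle_symm_apply_right.2 (Equiv.Perm.SameCycle.refl σ x))) fun h => ?_
  have h1 : (({x} : Set (Fin n)).indicator 1 : Fin n → ℚ) ∈ invariantFunctions σ := by
    rw [h]
    refine indicator_mem_invariantFunctions fun y => ?_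
    have : (σ * Equiv.swap x (σ.symm x)) x = x := by simp
    simp only [Set.mem_singleton_iff]
    rw [← (σ * Equiv.swap x (σ.symm x)).apply_eq_iff_eq (x := y) (y := x), this]
  have := h1 x
  simp [hx] at this

lemma exists_apply_ne (h : σ ≠ τ) : ∃ x, σ x ≠ τ x := by
  by_contra! hc
  exact h (Equiv.ext hc)

lemma exists_swap_factorization (σ : Equiv.Perm (Fin n)) :
    ∃ l : List (Equiv.Perm (Fin n)), (∀ t ∈ l, t.IsSwap) ∧ l.prod = σ ∧
      l.length + Module.finrank ℚ (invariantFunctions σ) ≤ n := by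
  by_cases h : σ = 1
  · exact ⟨[], by simp, by simp [h], by simpa using finrank_invariantFunctions_le⟩
  obtain ⟨x, hx⟩ := exists_apply_ne h
  have hx : σ x ≠ x := hx
  have hlt := Submodule.finrank_lt_finrank_of_lt (invariantFunctions_lt_mul_swap hx)
  have hle := finrank_invariantFunctions_le (σ := σ * Equiv.swap x (σ.symm x))
  obtain ⟨l, hl, hprod, hlen⟩ := exists_swap_factorization (σ * Equiv.swap x (σ.symm x))
  refine ⟨l ++ [Equiv.swap x (σ.symm x)], ?_, ?_, ?_⟩
  · intro t ht
    rcases List.mem_append.1 ht with ht | ht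
    · exact hl t ht
    · refine ⟨x, σ⁻¹ x, fun he => hx ?_, by simpa using ht⟩
      exact (Equiv.eq_symm_apply σ).1 he
  · simp [hprod, mul_assoc]
  · simp only [List.length_append, List.length_singleton]
    omega
termination_by n - Module.finrank ℚ (invariantFunctions σ)
decreasing_by exact Nat.sub_lt_sub_left (hlt.trans_le hle) hlt

lemma le_length_add_finrank (l : List (Equiv.Perm (Fin n))) (hl : ∀ t ∈ l, t.IsSwap) :
    n ≤ l.length + Module.finrank ℚ (invariantFunctions l.prod) := by
  induction l with
  | nil =>
    have : invariantFunctions (1 : Equiv.Perm (Fin n)) = ⊤ := by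
      ext f; simp [mem_invariantFunctions]
    rw [List.prod_nil, this]
    simp
  | cons t l ih =>
    have h1 := ih fun s hs => hl s (List.mem_cons_of_mem t hs)
    obtain ⟨u, v, -, rfl⟩ := hl t List.mem_cons_self
    have h2 := le_finrank_swap u v
    have h3 := finrank_add_le_mul (a := Equiv.swap u v) (b := l.prod)
    rw [List.length_cons, List.prod_cons]
    omega

/-- The reflection length of `σ` is the codimension of its space of invariant functions. -/
lemma reflectionLength_add_finrank (σ : Equiv.Perm (Fin n)) :
    reflectionLength σ + Module.finrank ℚ (invariantFunctions σ) = n := by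
  obtain ⟨l, hl, hprod, hlen⟩ := exists_swap_factorization σ
  have hmem : l.length ∈ {k | ∃ l : List (Equiv.Perm (Fin n)),
    l.length = k ∧ (∀ t ∈ l, t.IsSwap) ∧ l.prod = σ} := ⟨l, rfl, hl, hprod⟩
  have h1 : reflectionLength σ ≤ l.length := Nat.sInf_le hmem
  obtain ⟨l', hl', hsw, hprod'⟩ := Nat.sInf_mem ⟨_, hmem⟩
  have h2 := le_length_add_finrank l' hsw
  rw [hprod', hl'] at h2
  change n ≤ reflectionLength σ + _ at h2
  omega

lemma reflectionLength_mul_le (a b : Equiv.Perm (Fin n)) :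
    reflectionLength (a * b) ≤ reflectionLength a + reflectionLength b := by
  have h1 := reflectionLength_add_finrank a
  have h2 := reflectionLength_add_finrank b
  have h3 := reflectionLength_add_finrank (a * b)
  have h4 := finrank_add_le_mul (a := a) (b := b)
  omega

lemma reflectionLength_swap_le (u v : Fin n) : reflectionLength (Equiv.swap u v) ≤ 1 := by
  have h1 := reflectionLength_add_finrank (Equiv.swap u v)
  have h2 := le_finrank_swap u v
  omega

lemma reflectionLength_lt_of_lt (h : invariantFunctions σ < invariantFunctions τ) :
    reflectionLength τ < reflectionLength σ := by
  have h1 := reflectionLength_add_finrank σ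
  have h2 := reflectionLength_add_finrank τ
  have h3 := Submodule.finrank_lt_finrank_of_lt h
  omega

lemma reflectionLength_conj_le (g σ : Equiv.Perm (Fin n)) :
    reflectionLength (g * σ * g⁻¹) ≤ reflectionLength σ := by
  let φ : (Fin n → ℚ) →ₗ[ℚ] (Fin n → ℚ) := LinearMap.funLeft ℚ ℚ g.symm
  have hφ : Function.Injective φ :=
    LinearMap.funLeft_injective_of_surjective ℚ ℚ _ g.symm.surjective
  have h : (invariantFunctions σ).map φ ≤ invariantFunctions (g * σ * g⁻¹) := by
    rintro _ ⟨f, hf, rfl⟩ x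
    simpa [φ, LinearMap.funLeft_apply] using hf (g.symm x)
  have h1 := Submodule.finrank_mono h
  rw [← (Submodule.equivMapOfInjective φ hφ (invariantFunctions σ)).finrank_eq] at h1
  have h2 := reflectionLength_add_finrank σ
  have h3 := reflectionLength_add_finrank (g * σ * g⁻¹)
  omega

lemma reflectionLength_conj (g σ : Equiv.Perm (Fin n)) :
    reflectionLength (g * σ * g⁻¹) = reflectionLength σ := by
  refine le_antisymm (reflectionLength_conj_le g σ) ?_
  simpa [mul_assoc] using reflectionLength_conj_le g⁻¹ (g * σ * g⁻¹)

/-- If lengths add up in `a * b`, every invariant function of `a * b` is invariant under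
both factors. -/
lemma invariantFunctions_mul_le (h : reflectionLength a + reflectionLength b =
    reflectionLength (a * b)) :
    invariantFunctions (a * b) ≤ invariantFunctions a ⊓ invariantFunctions b := by
  have h1 := reflectionLength_add_finrank a
  have h2 := reflectionLength_add_finrank b
  have h3 := reflectionLength_add_finrank (a * b)
  have h4 := finrank_add_le_inf (a := a) (b := b)
  exact (Submodule.eq_of_le_of_finrank_le inf_le_invariantFunctions_mul (by omega)).ge

end InvariantFunctions

/-- `CyclicBetween a b y` says that `y` lies strictly inside the arc going up cyclically
from `a` to `b`; if `a = b`, that arc is the whole circle without `a`. -/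
def CyclicBetween {n : ℕ} (a b y : Fin n) : Prop :=
  if a < b then a < y ∧ y < b else a < y ∨ y < b

/-- A permutation is noncrossing if each open arc from `x` to `τ x` is mapped into
itself. -/
def IsNoncrossingPerm {n : ℕ} (τ : Equiv.Perm (Fin n)) : Prop :=
  ∀ x y, CyclicBetween x (τ x) y → CyclicBetween x (τ x) (τ y)

namespace IsNoncrossingPerm

variable {n : ℕ} {σ τ a b : Equiv.Perm (Fin n)}

lemma cyclicBetween_of_sameCycle (hτ : IsNoncrossingPerm τ) {x y z : Fin n}
    (h : τ.SameCycle y z) (hy : CyclicBetween x (τ x) y) : CyclicBetween x (τ x) z := by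
  obtain ⟨k, -, -, rfl⟩ := h.exists_pow_eq'
  clear h
  induction k with
  | zero => exact hy
  | succ k ih => rw [pow_succ', Equiv.Perm.mul_apply]; exact hτ _ _ ih

lemma cyclicBetween_apply_iff (hτ : IsNoncrossingPerm τ) (x y : Fin n) :
    CyclicBetween x (τ x) (τ y) ↔ CyclicBetween x (τ x) y :=
  ⟨hτ.cyclicBetween_of_sameCycle (Equiv.Perm.sameCycle_apply_left.2 (.refl τ y)), hτ x y⟩

lemma not_cyclicBetween (hτ : IsNoncrossingPerm τ) {x y : Fin n} (h : τ.SameCycle x y) :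
    ¬ CyclicBetween x (τ x) y := by
  intro hy
  have := hτ.cyclicBetween_of_sameCycle h.symm hy
  unfold CyclicBetween at this
  split_ifs at this <;> omega

lemma cyclicBetween_or_eq (hτ : IsNoncrossingPerm τ) {u v y : Fin n}
    (h : τ.SameCycle u v) (hy : CyclicBetween u v y) :
    CyclicBetween u v (τ y) ∨ τ y = v := by
  have h1 : CyclicBetween y (τ y) u → CyclicBetween y (τ y) v :=
    hτ.cyclicBetween_of_sameCycle h
  have h2 : CyclicBetween y (τ y) v → CyclicBetween y (τ y) u :=
    hτ.cyclicBetween_of_sameCycle h.symm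
  unfold CyclicBetween at *
  split_ifs at * <;> omega

lemma apply_ne_self {u v : Fin n} (h : τ.SameCycle u v) (huv : u ≠ v) : τ u ≠ u := by
  intro hu
  obtain ⟨k, hk⟩ := h
  exact huv (by rw [← hk, Equiv.Perm.zpow_apply_eq_self_of_apply_eq_self hu])

lemma cyclicBetween_apply_right (hτ : IsNoncrossingPerm τ) {u v : Fin n}
    (h : τ.SameCycle u v) (huv : u ≠ v) : CyclicBetween u (τ v) v := by
  have h1 := hτ.not_cyclicBetween h.symm
  have h2 := apply_ne_self h.symm huv.symm
  unfold CyclicBetween at *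
  split_ifs at * <;> omega

lemma cyclicBetween_apply_left (hτ : IsNoncrossingPerm τ) {u v : Fin n}
    (h : τ.SameCycle u v) (huv : u ≠ v) : CyclicBetween u (τ v) (τ u) := by
  have h1 := hτ.not_cyclicBetween h
  have h2 := apply_ne_self h huv
  have h3 := hτ.cyclicBetween_apply_right h huv
  have h4 : τ u ≠ τ v := τ.injective.ne huv
  unfold CyclicBetween at *
  split_ifs at * <;> omega

lemma cyclicBetween_mul_swap (hτ : IsNoncrossingPerm τ) {u v : Fin n}
    (h : τ.SameCycle u v) (huv : u ≠ v) {y : Fin n} (hy : CyclicBetween u (τ v) y) :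
    CyclicBetween u (τ v) ((τ * Equiv.swap u v) y) := by
  rw [Equiv.Perm.mul_apply]
  have hu : y ≠ u := by
    rintro rfl
    unfold CyclicBetween at hy
    split_ifs at hy <;> omega
  rcases eq_or_ne y v with rfl | hv
  · rw [Equiv.swap_apply_right]
    exact hτ.cyclicBetween_apply_left h huv
  · rw [Equiv.swap_apply_of_ne_of_ne hu hv]
    exact (hτ.cyclicBetween_or_eq (Equiv.Perm.sameCycle_apply_right.2 h) hy).resolve_right
      (τ.injective.ne hv)

/-- Splitting a cycle of a noncrossing permutation by a transposition gives a noncrossing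
permutation. -/
lemma mul_swap (hτ : IsNoncrossingPerm τ) {u v : Fin n} (h : τ.SameCycle u v) :
    IsNoncrossingPerm (τ * Equiv.swap u v) := by
  rcases eq_or_ne u v with rfl | huv
  · rwa [Equiv.swap_self, ← Equiv.Perm.one_def, mul_one]
  intro x y hy
  rcases eq_or_ne x u with rfl | hu
  · have hx : (τ * Equiv.swap x v) x = τ v := by simp
    rw [hx] at hy ⊢
    exact hτ.cyclicBetween_mul_swap h huv hy
  rcases eq_or_ne x v with rfl | hv
  · have hx : (τ * Equiv.swap u x) x = τ u := by simp
    rw [hx] at hy ⊢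
    rw [Equiv.swap_comm]
    exact hτ.cyclicBetween_mul_swap h.symm huv.symm hy
  have hx : (τ * Equiv.swap u v) x = τ x := by
    rw [Equiv.Perm.mul_apply, Equiv.swap_apply_of_ne_of_ne hu hv]
  rw [hx] at hy ⊢
  rw [Equiv.Perm.mul_apply]
  refine hτ.cyclicBetween_of_sameCycle (Equiv.Perm.sameCycle_apply_right.2 ?_) hy
  rcases eq_or_ne y u with rfl | hyu
  · simpa using h
  rcases eq_or_ne y v with rfl | hyv
  · simpa using h.symm
  rw [Equiv.swap_apply_of_ne_of_ne hyu hyv]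

/-- Left divisors of noncrossing permutations are noncrossing. -/
lemma of_mul_left {b : Equiv.Perm (Fin n)} (h : IsNoncrossingPerm (a * b))
    (hlen : reflectionLength a + reflectionLength b = reflectionLength (a * b)) :
    IsNoncrossingPerm a := by
  by_cases hb : b = 1
  · simpa [hb] using h
  obtain ⟨x, hx⟩ := exists_apply_ne hb
  have hx : b x ≠ x := hx
  have hcyc : (a * b).SameCycle x (b.symm x) := by
    have := sameCycle_of_le ((invariantFunctions_mul_le hlen).trans inf_le_right) (b.symm x)
    rw [Equiv.apply_symm_apply] at this
    exact this.symm
  have h1 := h.mul_swap hcyc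
  have h2 := reflectionLength_lt_of_lt (invariantFunctions_lt_mul_swap hx)
  have h3 := reflectionLength_mul_le a (b * Equiv.swap x (b.symm x))
  have h4 := reflectionLength_mul_le (a * b * Equiv.swap x (b.symm x)) (Equiv.swap x (b.symm x))
  have h5 := reflectionLength_swap_le x (b.symm x)
  rw [Equiv.mul_swap_mul_self] at h4
  rw [mul_assoc] at h1 h4
  exact of_mul_left h1 (by omega)
termination_by reflectionLength b

/-- Right divisors of noncrossing permutations are noncrossing. -/
lemma of_mul_right (h : IsNoncrossingPerm (a * b))
    (hlen : reflectionLength a + reflectionLength b = reflectionLength (a * b)) :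
    IsNoncrossingPerm b := by
  have hab : a * b = b * (b⁻¹ * a * b⁻¹⁻¹) := by group
  rw [hab] at h
  refine h.of_mul_left ?_
  rw [reflectionLength_conj, ← hab]
  omega

/-- Among noncrossing permutations, refinement of cycles implies additivity of lengths. -/
lemma reflectionLength_add_of_le {τ : Equiv.Perm (Fin n)} (hσ : IsNoncrossingPerm σ)
    (hτ : IsNoncrossingPerm τ)
    (hle : invariantFunctions τ ≤ invariantFunctions σ) :
    reflectionLength σ + reflectionLength (σ⁻¹ * τ) = reflectionLength τ := by
  classical
  have hsub := reflectionLength_mul_le σ (σ⁻¹ * τ)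
  rw [mul_inv_cancel_left] at hsub
  refine le_antisymm ?_ hsub
  by_cases h : σ = τ
  · have h1 : reflectionLength (1 : Equiv.Perm (Fin n)) = 0 :=
      Nat.sInf_eq_zero.2 (Or.inl ⟨[], rfl, by simp, rfl⟩)
    simp [h, h1]
  obtain ⟨u, hu⟩ := exists_apply_ne h
  obtain ⟨v, hv⟩ := τ.surjective (σ u)
  have huv : u ≠ v := by rintro rfl; exact hu hv.symm
  have hcyc : τ.SameCycle u v := by
    have := sameCycle_of_le hle u
    rwa [← hv, Equiv.Perm.sameCycle_apply_right] at this
  have hτ' := hτ.mul_swap hcyc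
  have happ : (τ * Equiv.swap u v) u = σ u := by simp [hv]
  have hv' : CyclicBetween u (σ u) v := hv ▸ hτ.cyclicBetween_apply_right hcyc huv
  have hu' : ¬ CyclicBetween u (σ u) u := by
    unfold CyclicBetween; split_ifs <;> omega
  have hw' : ¬ CyclicBetween u (σ u) (σ u) := by
    unfold CyclicBetween; split_ifs <;> omega
  let S : Set (Fin n) := {y | CyclicBetween u (σ u) y}
  let g : Fin n → ℚ := S.indicator 1
  have hgσ : g ∈ invariantFunctions σ :=
    indicator_mem_invariantFunctions (hσ.cyclicBetween_apply_iff u)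
  have hgτ' : g ∈ invariantFunctions (τ * Equiv.swap u v) :=
    indicator_mem_invariantFunctions fun y => by
      have := hτ'.cyclicBetween_apply_iff u y
      rwa [happ] at this
  have hgv : g v = 1 := by simp [g, S, hv']
  have hgu : g u = 0 := by simp [g, S, hu']
  have hgw : g (σ u) = 0 := by simp [g, S, hw']
  have hle' : invariantFunctions (τ * Equiv.swap u v) ≤ invariantFunctions σ := by
    intro f hf
    have h1 : f - (f v - f u) • g ∈ invariantFunctions (τ * Equiv.swap u v) :=
      Submodule.sub_mem _ hf (Submodule.smul_mem _ _ hgτ')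
    have h2 : f - (f v - f u) • g ∈ invariantFunctions (Equiv.swap u v) := by
      rw [mem_invariantFunctions_swap]
      simp [hgu, hgv]
    have h3 := inf_le_invariantFunctions_mul (Submodule.mem_inf.2 ⟨h1, h2⟩)
    rw [Equiv.mul_swap_mul_self] at h3
    have h4 := Submodule.add_mem _ (hle h3) (Submodule.smul_mem _ (f v - f u) hgσ)
    simpa using h4
  have hlt : invariantFunctions τ < invariantFunctions (τ * Equiv.swap u v) := by
    refine lt_of_le_of_ne (le_invariantFunctions_mul_swap hcyc) fun he => ?_
    rw [← he] at hgτ'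
    have := hgτ' v
    rw [hv, hgw, hgv] at this
    exact zero_ne_one this
  have h1 := reflectionLength_lt_of_lt hlt
  have h2 := reflectionLength_add_of_le hσ hτ' hle'
  have h3 := reflectionLength_mul_le (σ⁻¹ * (τ * Equiv.swap u v)) (Equiv.swap u v)
  have h4 := reflectionLength_swap_le u v
  rw [mul_assoc, Equiv.mul_swap_mul_self] at h3
  omega
termination_by reflectionLength τ

/-- A noncrossing permutation is the block rotation of the partition into its cycles. -/
lemma exists_isBlockRotation (hτ : IsNoncrossingPerm τ) :
    ∃ r : NC n, IsBlockRotation r.val τ := by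
  classical
  let P := Finpartition.ofSetoid (Equiv.Perm.SameCycle.setoid τ)
  have hpart : ∀ x y, y ∈ P.part x ↔ τ.SameCycle x y := fun x y =>
    Finpartition.mem_part_ofSetoid_iff_rel
  refine ⟨⟨P, ?_⟩, ?_⟩
  · rintro ⟨a, b, c, d, hab, hbc, hcd, B, hB, B', hB', hne, ha, hc, hb, hd⟩
    have hBa := P.part_eq_of_mem hB ha
    have hBb := P.part_eq_of_mem hB' hb
    have hac : τ.SameCycle a c := (hpart a c).1 (hBa ▸ hc)
    have hbd : τ.SameCycle b d := (hpart b d).1 (hBb ▸ hd)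
    have hbc' : ¬ τ.SameCycle b c := fun h =>
      hne (P.eq_of_mem_parts hB hB' hc (hBb ▸ (hpart b c).2 h))
    obtain ⟨k, -, -, rfl⟩ := hbd.exists_pow_eq'
    have hk : ∀ k : ℕ, CyclicBetween a c ((τ ^ k) b) := by
      intro k
      induction k with
      | zero =>
        unfold CyclicBetween
        rw [if_pos (hab.trans hbc)]
        exact ⟨hab, hbc⟩
      | succ k ih =>
        have := hτ.cyclicBetween_or_eq hac ih
        rw [← Equiv.Perm.mul_apply, ← pow_succ'] at this
        exact this.resolve_right fun he => hbc' ⟨(k + 1 : ℕ), by rw [zpow_natCast]; exact he⟩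
    have := hk k
    unfold CyclicBetween at this
    rw [if_pos (hab.trans hbc)] at this
    omega
  · intro x
    have hmem : τ x ∈ P.part x := (hpart x _).2 (Equiv.Perm.sameCycle_apply_right.2 (.refl τ x))
    have hgap : ∀ z ∈ P.part x, ¬ CyclicBetween x (τ x) z := fun z hz =>
      hτ.not_cyclicBetween ((hpart x z).1 hz)
    unfold CyclicBetween at hgap
    split_ifs with h
    · obtain ⟨z, hz⟩ := h
      have hlt : x < τ x := by
        rw [mem_filter] at hz
        have := hgap z hz.1
        split_ifs at this <;> omega
      simp only [if_pos hlt] at hgap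
      refine le_antisymm (le_min' _ _ _ fun z hz => ?_)
        (min'_le _ _ (mem_filter.2 ⟨hmem, hlt⟩))
      rw [mem_filter] at hz
      have := hgap z hz.1
      omega
    · have hle : ¬ x < τ x := fun hlt => h ⟨_, mem_filter.2 ⟨hmem, hlt⟩⟩
      simp only [if_neg hle] at hgap
      refine le_antisymm (le_min' _ _ _ fun z hz => ?_) (min'_le _ _ hmem)
      have := hgap z hz
      omega

end IsNoncrossingPerm

namespace IsBlockRotation

variable {n : ℕ} {P Q : Finpartition (univ : Finset (Fin n))} {σ τ : Equiv.Perm (Fin n)}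

lemma unique (hσ : IsBlockRotation P σ) (hτ : IsBlockRotation P τ) : σ = τ :=
  Equiv.ext fun x => (hσ x).trans (hτ x).symm

lemma apply_mem_part (h : IsBlockRotation P σ) (x : Fin n) : σ x ∈ P.part x := by
  rw [h x]
  split_ifs with hx
  · exact (mem_filter.1 (min'_mem _ hx)).1
  · exact min'_mem _ _

lemma not_cyclicBetween (h : IsBlockRotation P σ) {x y : Fin n} (hy : y ∈ P.part x) :
    ¬ CyclicBetween x (σ x) y := by
  rw [h x]
  split_ifs with hx
  · have h1 := (mem_filter.1 (min'_mem _ hx)).2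
    unfold CyclicBetween
    rw [if_pos h1]
    rintro ⟨h2, h3⟩
    exact absurd (min'_le _ _ (mem_filter.2 ⟨hy, h2⟩)) (not_le.2 h3)
  · have h1 := min'_le (P.part x) x (P.mem_part (mem_univ x))
    unfold CyclicBetween
    rw [if_neg (not_lt.2 h1)]
    rintro (h2 | h2)
    · exact hx ⟨y, mem_filter.2 ⟨hy, h2⟩⟩
    · exact absurd (min'_le _ _ hy) (not_le.2 h2)

lemma sameCycle_min' (h : IsBlockRotation P σ) (x : Fin n) :
    σ.SameCycle x ((P.part x).min' ⟨x, P.mem_part (mem_univ x)⟩) := by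
  by_cases hx : ((P.part x).filter (x < ·)).Nonempty
  · have hlt : x < σ x := by
      rw [h x, dif_pos hx]
      exact (mem_filter.1 (min'_mem _ hx)).2
    have hpart : P.part (σ x) = P.part x :=
      P.part_eq_of_mem (P.part_mem.2 (mem_univ x)) (h.apply_mem_part x)
    have ih := h.sameCycle_min' (σ x)
    simp only [hpart] at ih
    exact Equiv.Perm.sameCycle_apply_left.1 ih
  · have := h x
    rw [dif_neg hx] at this
    rw [← this]
    exact Equiv.Perm.sameCycle_apply_right.2 (.refl σ x)
termination_by n - x.val

lemma sameCycle_of_mem_part (h : IsBlockRotation P σ) {x y : Fin n} (hy : y ∈ P.part x) :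
    σ.SameCycle x y := by
  have hpart : P.part y = P.part x :=
    P.part_eq_of_mem (P.part_mem.2 (mem_univ x)) hy
  have h1 := h.sameCycle_min' y
  simp only [hpart] at h1
  exact (h.sameCycle_min' x).trans h1.symm

lemma apply_mem_part_iff (h : IsBlockRotation P σ) (x y : Fin n) :
    σ y ∈ P.part x ↔ y ∈ P.part x := by
  have hpart : P.part (σ y) = P.part y :=
    P.part_eq_of_mem (P.part_mem.2 (mem_univ y)) (h.apply_mem_part y)
  rw [P.mem_part_iff_part_eq_part (mem_univ _) (mem_univ _), hpart,
    ← P.mem_part_iff_part_eq_part (mem_univ _) (mem_univ _)]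

/-- Refinement of partitions in terms of invariant functions of the block rotations. -/
lemma le_iff (hP : IsBlockRotation P σ) (hQ : IsBlockRotation Q τ) :
    P ≤ Q ↔ invariantFunctions τ ≤ invariantFunctions σ := by
  classical
  constructor
  · intro hle f hf x
    obtain ⟨C, hC, hsub⟩ := hle (P.part_mem.2 (mem_univ x))
    have hx := Q.part_eq_of_mem hC (hsub (P.mem_part (mem_univ x)))
    have hσx : σ x ∈ Q.part x := hx ▸ hsub (hP.apply_mem_part x)
    exact (eq_of_sameCycle hf (hQ.sameCycle_of_mem_part hσx)).symm
  · intro hle B hB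
    obtain ⟨x, hx⟩ := P.nonempty_of_mem_parts hB
    refine ⟨Q.part x, Q.part_mem.2 (mem_univ x), fun y hy => ?_⟩
    have hyx : y ∈ P.part x := (P.part_eq_of_mem hB hx).symm ▸ hy
    have h1 := eq_of_sameCycle (hle (indicator_mem_invariantFunctions (S := {y | y ∈ Q.part x})
      (hQ.apply_mem_part_iff x))) (hP.sameCycle_of_mem_part hyx)
    by_contra hc
    simp [hc, Q.mem_part (mem_univ x)] at h1

/-- The block rotation of a noncrossing partition is a noncrossing permutation. -/
lemma isNoncrossingPerm (h : IsBlockRotation P σ) (hP : IsNoncrossing P) :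
    IsNoncrossingPerm σ := by
  intro x y hy
  by_contra hc
  have hyx : y ∉ P.part x := fun hyx => h.not_cyclicBetween hyx hy
  have hne : P.part x ≠ P.part y := fun he => hyx (he ▸ P.mem_part (mem_univ y))
  have hx1 := P.mem_part (mem_univ x)
  have hx2 := h.apply_mem_part x
  have hy1 := P.mem_part (mem_univ y)
  have hy2 := h.apply_mem_part y
  have hdisj : ∀ u ∈ P.part x, ∀ v ∈ P.part y, u ≠ v := by
    rintro u hu _ hv rfl
    exact hne (P.eq_of_mem_parts (P.part_mem.2 (mem_univ x)) (P.part_mem.2 (mem_univ y)) hu hv)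
  have d1 := hdisj _ hx1 _ hy1
  have d2 := hdisj _ hx1 _ hy2
  have d3 := hdisj _ hx2 _ hy1
  have d4 := hdisj _ hx2 _ hy2
  have cross : ∀ a b c d : Fin n, a ∈ P.part x → c ∈ P.part x → b ∈ P.part y → d ∈ P.part y →
      ¬ (a < b ∧ b < c ∧ c < d) ∧ ¬ (b < c ∧ c < d ∧ d < a) := by
    refine fun a b c d ha hc hb hd => ⟨fun hm => hP ?_, fun hm => hP ?_⟩
    · exact ⟨a, b, c, d, hm.1, hm.2.1, hm.2.2, _, P.part_mem.2 (mem_univ x), _,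
        P.part_mem.2 (mem_univ y), hne, ha, hc, hb, hd⟩
    · exact ⟨b, c, d, a, hm.1, hm.2.1, hm.2.2, _, P.part_mem.2 (mem_univ y), _,
        P.part_mem.2 (mem_univ x), hne.symm, hb, hd, hc, ha⟩
  have c1 := cross x y (σ x) (σ y) hx1 hx2 hy1 hy2
  have c2 := cross (σ x) (σ y) x y hx2 hx1 hy2 hy1
  have c3 := cross x (σ y) (σ x) y hx1 hx2 hy2 hy1
  have c4 := cross (σ x) y x (σ y) hx2 hx1 hy1 hy2
  unfold CyclicBetween at hy hc
  split_ifs at hy hc <;> omega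

end IsBlockRotation

/-- For non-crossing partitions `p, q` of `Fin n` the following are equivalent:
(1) `p ⪯ q` in `NC n`; (2) `s p` is a left-divisor of `s q`, witnessed by some
`r ∈ NC n`; (3) `s p` is a right-divisor of `s q`, witnessed by some `r ∈ NC n`;
(4) `s p ≤_T s q` in the absolute order on `Sₙ`. -/
theorem noncrossing_divisibility_tfae (n : ℕ)
    (s : NC n → Equiv.Perm (Fin n)) (hs : ∀ p : NC n, IsBlockRotation p.val (s p))
    (p q : NC n) :
    (p ≤ q ↔ ∃ r : NC n, s q = s p * s r ∧
        reflectionLength (s p) + reflectionLength (s r) = reflectionLength (s q)) ∧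
    (p ≤ q ↔ ∃ r : NC n, s q = s r * s p ∧
        reflectionLength (s r) + reflectionLength (s p) = reflectionLength (s q)) ∧
    (p ≤ q ↔ absoluteLe (s p) (s q)) := by
  have hsp := (hs p).isNoncrossingPerm p.2
  have hsq := (hs q).isNoncrossingPerm q.2
  have hle : p ≤ q ↔ invariantFunctions (s q) ≤ invariantFunctions (s p) := (hs p).le_iff (hs q)
  have hadd : p ≤ q → reflectionLength (s p) + reflectionLength ((s p)⁻¹ * s q) =
      reflectionLength (s q) := fun h => hsp.reflectionLength_add_of_le hsq (hle.1 h)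
  have hreal : ∀ σ, IsNoncrossingPerm σ → ∃ r : NC n, s r = σ := fun σ hσ =>
    hσ.exists_isBlockRotation.imp fun r hr => (hs r).unique hr
  refine ⟨⟨fun h => ?_, ?_⟩, ⟨fun h => ?_, ?_⟩, ⟨hadd, fun h => ?_⟩⟩
  · have hmul : s p * ((s p)⁻¹ * s q) = s q := mul_inv_cancel_left _ _
    obtain ⟨r, hr⟩ := hreal _ (IsNoncrossingPerm.of_mul_right (a := s p) (by rwa [hmul])
      (by rw [hmul]; exact hadd h))
    exact ⟨r, by rw [hr, hmul], by rw [hr]; exact hadd h⟩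
  · rintro ⟨r, hr, hlen⟩
    rw [hr] at hlen
    exact hle.2 (hr ▸ (invariantFunctions_mul_le hlen).trans inf_le_left)
  · have hmul : s q * (s p)⁻¹ * s p = s q := inv_mul_cancel_right _ _
    have hconj : s q * (s p)⁻¹ = s p * ((s p)⁻¹ * s q) * (s p)⁻¹ := by group
    have hlen : reflectionLength (s q * (s p)⁻¹) + reflectionLength (s p) =
        reflectionLength (s q) := by
      rw [hconj, reflectionLength_conj, add_comm]
      exact hadd h
    obtain ⟨r, hr⟩ := hreal _ (IsNoncrossingPerm.of_mul_left (b := s p) (by rwa [hmul])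
      (by rwa [hmul]))
    exact ⟨r, by rw [hr, hmul], by rwa [hr]⟩
  · rintro ⟨r, hr, hlen⟩
    rw [hr] at hlen
    exact hle.2 (hr ▸ (invariantFunctions_mul_le hlen).trans inf_le_right)
  · have hmul : s p * ((s p)⁻¹ * s q) = s q := mul_inv_cancel_left _ _
    have h' : reflectionLength (s p) + reflectionLength ((s p)⁻¹ * s q) =
      reflectionLength (s p * ((s p)⁻¹ * s q)) := by rw [hmul]; exact h
    have := (invariantFunctions_mul_le h').trans inf_le_left
    rw [hmul] at this
    exact hle.2 this
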